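/- Let Δ Φ := |Φ(ρ,Π) − Φ(σ,Π)| be the difference of coherences of two density operators ρ, σ with trace distance T(ρ,σ) ≤ 1/e on a d-dimensional Hilbert space. Then ΔΦ ≤ 2[T(ρ,σ) log₂ d − T(ρ,σ) log₂ T(ρ,σ)] (continuity of coherence). -/

import Mathlib

open Matrix Finset Kronecker
open scoped ComplexOrder
noncomputable section

/-- Apply a real function to a Hermitian matrix via its spectral decomposition
(junk value `0` if the matrix is not Hermitian). -/
def herFun (f : ℝ → ℝ) {n : Type*} [Fintype n] [DecidableEq n]
    (A : Matrix n n ℂ) : Matrix n n ℂ :=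
  if hA : A.IsHermitian then
    (hA.eigenvectorUnitary : Matrix n n ℂ) *
      Matrix.diagonal (fun i => (f (hA.eigenvalues i) : ℂ)) *
      (star (hA.eigenvectorUnitary : Matrix n n ℂ))
  else 0

/-- Matrix logarithm (natural base) of a Hermitian matrix. -/
def matLog {n : Type*} [Fintype n] [DecidableEq n] (A : Matrix n n ℂ) : Matrix n n ℂ :=
  herFun Real.log A

/-- Von Neumann entropy (natural base): `H(ρ) = -Tr(ρ log ρ)`. -/
def vnEnt {n : Type*} [Fintype n] [DecidableEq n] (ρ : Matrix n n ℂ) : ℝ :=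
  -((ρ * matLog ρ).trace).re

/-- Quantum relative entropy (natural base): `D(ρ‖τ) = Tr(ρ log ρ) - Tr(ρ log τ)`. -/
def relEnt {n : Type*} [Fintype n] [DecidableEq n] (ρ τ : Matrix n n ℂ) : ℝ :=
  ((ρ * matLog ρ).trace - (ρ * matLog τ).trace).re

/-- Von Neumann entropy in base 2: `H₂(ρ) = -Tr(ρ log₂ ρ)`. -/
def vnEnt2 {n : Type*} [Fintype n] [DecidableEq n] (ρ : Matrix n n ℂ) : ℝ :=
  -((ρ * herFun (Real.logb 2) ρ).trace).re

/-- Coherence (base 2): `Φ(ρ, P) = H₂(∑ j, P j ρ P j) - H₂(ρ)`. -/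
def coherence2 {n : Type*} [Fintype n] [DecidableEq n] {m : ℕ}
    (ρ : Matrix n n ℂ) (P : Fin m → Matrix n n ℂ) : ℝ :=
  vnEnt2 (∑ j, P j * ρ * P j) - vnEnt2 ρ

/-- Trace distance `T(ρ,σ) = (1/2) Tr |ρ - σ|`, where `|A| = √(Aᴴ A)`. -/
def traceDist {n : Type*} [Fintype n] [DecidableEq n] (ρ σ : Matrix n n ℂ) : ℝ :=
  (1 / 2) * ((herFun Real.sqrt ((ρ - σ)ᴴ * (ρ - σ))).trace).re

theorem Matrix.PosSemidef.re_trace_nonneg {n : Type*} [Fintype n] {A : Matrix n n ℂ}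
    (hA : A.PosSemidef) : 0 ≤ A.trace.re :=
  (Complex.nonneg_iff.mp hA.trace_nonneg).1

theorem posSemidef_smul_one {n : Type*} [DecidableEq n] {c : ℝ} (hc : 0 ≤ c) :
    ((c : ℂ) • (1 : Matrix n n ℂ)).PosSemidef := by
  rw [smul_one_eq_diagonal]
  exact PosSemidef.diagonal fun _ => by simpa using hc

section Spectral

variable {n : Type*} [Fintype n] [DecidableEq n] {A B A' B' : Matrix n n ℂ}

theorem Matrix.IsHermitian.eq_unitary_mul_diagonal (hA : A.IsHermitian) :
    A = (hA.eigenvectorUnitary : Matrix n n ℂ) *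
      diagonal (fun i => (hA.eigenvalues i : ℂ)) *
      (hA.eigenvectorUnitary : Matrix n n ℂ)ᴴ :=
  hA.spectral_theorem

theorem Matrix.IsHermitian.eigenvectorUnitary_conjTranspose_mul (hA : A.IsHermitian) :
    (hA.eigenvectorUnitary : Matrix n n ℂ)ᴴ * (hA.eigenvectorUnitary : Matrix n n ℂ) = 1 :=
  Unitary.coe_star_mul_self hA.eigenvectorUnitary

theorem Matrix.IsHermitian.eigenvectorUnitary_mul_conjTranspose (hA : A.IsHermitian) :
    (hA.eigenvectorUnitary : Matrix n n ℂ) * (hA.eigenvectorUnitary : Matrix n n ℂ)ᴴ = 1 :=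
  Unitary.coe_mul_star_self hA.eigenvectorUnitary

theorem herFun_of_isHermitian (f : ℝ → ℝ) (hA : A.IsHermitian) :
    herFun f A = (hA.eigenvectorUnitary : Matrix n n ℂ) *
      diagonal (fun i => (f (hA.eigenvalues i) : ℂ)) *
      (hA.eigenvectorUnitary : Matrix n n ℂ)ᴴ :=
  dif_pos hA

theorem herFun_eq_cfc (f : ℝ → ℝ) (hA : A.IsHermitian) : herFun f A = cfc f A := by
  rw [hA.cfc_eq]
  exact herFun_of_isHermitian f hA

theorem trace_herFun (f : ℝ → ℝ) (hA : A.IsHermitian) :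
    (herFun f A).trace.re = ∑ i, f (hA.eigenvalues i) := by
  rw [herFun_of_isHermitian f hA, Matrix.trace_mul_cycle,
    hA.eigenvectorUnitary_conjTranspose_mul, one_mul, trace_diagonal]
  simp

theorem Matrix.IsHermitian.re_trace_eq_sum (hA : A.IsHermitian) :
    A.trace.re = ∑ i, hA.eigenvalues i := by
  rw [hA.trace_eq_sum_eigenvalues]
  simp

/-- Squared moduli of the inner products between the eigenvectors of `A` and those of `B`. -/
def overlap (hA : A.IsHermitian) (hB : B.IsHermitian) (i j : n) : ℝ :=
  Complex.normSq (((hA.eigenvectorUnitary : Matrix n n ℂ)ᴴ *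
    (hB.eigenvectorUnitary : Matrix n n ℂ)) i j)

theorem overlap_nonneg (hA : A.IsHermitian) (hB : B.IsHermitian) (i j : n) :
    0 ≤ overlap hA hB i j :=
  Complex.normSq_nonneg _

theorem overlap_comm (hA : A.IsHermitian) (hB : B.IsHermitian) (i j : n) :
    overlap hA hB i j = overlap hB hA j i := by
  have h : (hA.eigenvectorUnitary : Matrix n n ℂ)ᴴ * (hB.eigenvectorUnitary : Matrix n n ℂ) =
      ((hB.eigenvectorUnitary : Matrix n n ℂ)ᴴ * (hA.eigenvectorUnitary : Matrix n n ℂ))ᴴ := by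
    simp
  rw [overlap, overlap, h, conjTranspose_apply, Complex.star_def, Complex.normSq_conj]

theorem sum_overlap_right (hA : A.IsHermitian) (hB : B.IsHermitian) (i : n) :
    ∑ j, overlap hA hB i j = 1 := by
  set U := (hA.eigenvectorUnitary : Matrix n n ℂ)
  set V := (hB.eigenvectorUnitary : Matrix n n ℂ)
  have h : (Uᴴ * V) * (Uᴴ * V)ᴴ = 1 := by
    rw [conjTranspose_mul, conjTranspose_conjTranspose, Matrix.mul_assoc, ← Matrix.mul_assoc V,
      hB.eigenvectorUnitary_mul_conjTranspose, one_mul, hA.eigenvectorUnitary_conjTranspose_mul]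
  have h2 := congrFun (congrFun h i) i
  rw [mul_apply, one_apply_eq] at h2
  have h3 := congrArg Complex.re h2
  rw [Complex.re_sum, Complex.one_re] at h3
  rw [← h3]
  refine Finset.sum_congr rfl fun j _ => ?_
  rw [conjTranspose_apply, Complex.star_def, Complex.mul_conj, Complex.ofReal_re]
  rfl

theorem sum_overlap_left (hA : A.IsHermitian) (hB : B.IsHermitian) (j : n) :
    ∑ i, overlap hA hB i j = 1 := by
  simp_rw [overlap_comm hA hB]
  exact sum_overlap_right hB hA j

theorem re_trace_diagonal_mul_mul_diagonal_mul (p q : n → ℝ) (W : Matrix n n ℂ) :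
    (diagonal (fun i => (p i : ℂ)) * W * diagonal (fun j => (q j : ℂ)) * Wᴴ).trace.re =
      ∑ i, ∑ j, Complex.normSq (W i j) * (p i * q j) := by
  rw [trace, Complex.re_sum]
  refine Finset.sum_congr rfl fun i _ => ?_
  rw [diag_apply, mul_apply, Complex.re_sum]
  refine Finset.sum_congr rfl fun j _ => ?_
  rw [mul_diagonal, diagonal_mul, conjTranspose_apply, Complex.star_def]
  have : (p i : ℂ) * W i j * q j * (starRingEnd ℂ) (W i j) =
      ((Complex.normSq (W i j) * (p i * q j) : ℝ) : ℂ) := by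
    push_cast
    rw [← Complex.mul_conj]
    ring
  rw [this, Complex.ofReal_re]

theorem re_trace_mul_herFun (f : ℝ → ℝ) (hA : A.IsHermitian) (hB : B.IsHermitian) :
    (A * herFun f B).trace.re =
      ∑ i, ∑ j, overlap hA hB i j * (hA.eigenvalues i * f (hB.eigenvalues j)) := by
  rw [herFun_of_isHermitian f hB]
  simp only [overlap]
  rw [← re_trace_diagonal_mul_mul_diagonal_mul hA.eigenvalues (fun j => f (hB.eigenvalues j))]
  conv_lhs => rw [hA.eq_unitary_mul_diagonal]
  rw [conjTranspose_mul, conjTranspose_conjTranspose]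
  simp only [Matrix.mul_assoc]
  rw [Matrix.trace_mul_comm]
  simp only [Matrix.mul_assoc]

theorem re_trace_mul_herFun_self (f : ℝ → ℝ) (hA : A.IsHermitian) :
    (A * herFun f A).trace.re = ∑ i, hA.eigenvalues i * f (hA.eigenvalues i) := by
  rw [herFun_of_isHermitian f hA]
  conv_lhs => enter [1, 1, 1]; rw [hA.eq_unitary_mul_diagonal]
  rw [Matrix.trace_mul_comm]
  simp only [← Matrix.mul_assoc]
  rw [Matrix.trace_mul_comm]
  simp only [← Matrix.mul_assoc]
  rw [hA.eigenvectorUnitary_conjTranspose_mul, one_mul, Matrix.mul_assoc,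
    Matrix.mul_assoc, ← Matrix.mul_assoc _ᴴ, hA.eigenvectorUnitary_conjTranspose_mul, one_mul,
    diagonal_mul_diagonal, trace_diagonal]
  simp [mul_comm]

theorem sum_overlap_mul_left (hA : A.IsHermitian) (hB : B.IsHermitian) (g : n → ℝ) :
    ∑ i, ∑ j, overlap hA hB i j * g i = ∑ i, g i := by
  simp_rw [← Finset.sum_mul, sum_overlap_right, one_mul]

theorem sum_overlap_mul_right (hA : A.IsHermitian) (hB : B.IsHermitian) (g : n → ℝ) :
    ∑ i, ∑ j, overlap hA hB i j * g j = ∑ j, g j := by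
  rw [Finset.sum_comm]
  simp_rw [← Finset.sum_mul, sum_overlap_left, one_mul]

theorem sum_overlap_mul_eigenvalues_le (hA : A.IsHermitian) (hB : B.IsHermitian)
    (hAB : (B - A).PosSemidef) (j : n) :
    ∑ i, overlap hA hB i j * hA.eigenvalues i ≤ hB.eigenvalues j := by
  set U := (hA.eigenvectorUnitary : Matrix n n ℂ) with hU
  set V := (hB.eigenvectorUnitary : Matrix n n ℂ) with hV
  have h := (hAB.conjTranspose_mul_mul_same V).diag_nonneg (i := j)
  have h1 : Vᴴ * B * V = diagonal (fun i => (hB.eigenvalues i : ℂ)) := by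
    conv_lhs => enter [1, 2]; rw [hB.eq_unitary_mul_diagonal]
    rw [← hV]
    simp only [← Matrix.mul_assoc]
    rw [hB.eigenvectorUnitary_conjTranspose_mul, one_mul, Matrix.mul_assoc,
      hB.eigenvectorUnitary_conjTranspose_mul, mul_one]
  have h2 : Vᴴ * A * V = (Uᴴ * V)ᴴ * diagonal (fun i => (hA.eigenvalues i : ℂ)) * (Uᴴ * V) := by
    conv_lhs => enter [1, 2]; rw [hA.eq_unitary_mul_diagonal]
    simp [← hU, Matrix.mul_assoc]
  have h3 : ((Vᴴ * A * V) j j).re = ∑ i, overlap hA hB i j * hA.eigenvalues i := by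
    rw [h2, mul_apply, Complex.re_sum]
    refine Finset.sum_congr rfl fun i _ => ?_
    rw [mul_diagonal, conjTranspose_apply, Complex.star_def, overlap, ← hU, ← hV, mul_right_comm,
      ← Complex.normSq_eq_conj_mul_self]
    simp
  have h4 := (Complex.nonneg_iff.mp h).1
  rw [Matrix.mul_sub, Matrix.sub_mul, Matrix.sub_apply, Complex.sub_re, h1, h3] at h4
  simpa using h4

theorem overlap_mul_eigenvalues_eq_zero (hA : A.PosSemidef) (hB : B.IsHermitian)
    (hAB : (B - A).PosSemidef) (i : n) {j : n} (hj : hB.eigenvalues j = 0) :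
    overlap hA.isHermitian hB i j * hA.isHermitian.eigenvalues i = 0 := by
  have h := sum_overlap_mul_eigenvalues_le hA.isHermitian hB hAB j
  have h0 : ∀ k ∈ Finset.univ,
      0 ≤ overlap hA.isHermitian hB k j * hA.isHermitian.eigenvalues k := fun k _ =>
    mul_nonneg (overlap_nonneg _ _ _ _) (hA.eigenvalues_nonneg k)
  rw [hj] at h
  exact (Finset.sum_eq_zero_iff_of_nonneg h0).1 (le_antisymm h (Finset.sum_nonneg h0)) i
    (Finset.mem_univ i)

theorem relEnt_eq_sum (hA : A.IsHermitian) (hB : B.IsHermitian) :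
    relEnt A B = ∑ i, ∑ j, overlap hA hB i j * (hA.eigenvalues i *
      (Real.log (hA.eigenvalues i) - Real.log (hB.eigenvalues j))) := by
  rw [relEnt, Complex.sub_re, matLog, matLog, re_trace_mul_herFun_self _ hA,
    re_trace_mul_herFun _ hA hB, ← sum_overlap_mul_left hA hB]
  simp_rw [← Finset.sum_sub_distrib, mul_sub]

/-- The function `s ↦ Tr A (L_B + s R_A)⁻¹ A` in spectral coordinates. -/
def resolventForm (s : ℝ) (hA : A.IsHermitian) (hB : B.IsHermitian) : ℝ :=
  ∑ i, ∑ j, overlap hA hB i j *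
    (hA.eigenvalues i ^ 2 / (hB.eigenvalues j + s * hA.eigenvalues i))

/-- The quadratic functional whose supremum over `X` is the resolvent form. -/
def variationalForm (s : ℝ) (X A B : Matrix n n ℂ) : ℝ :=
  2 * (Xᴴ * A).trace.re - (Xᴴ * B * X).trace.re - s * (X * A * Xᴴ).trace.re

theorem variationalForm_eigenvectorUnitary (s : ℝ) (hA : A.IsHermitian) (hB : B.IsHermitian)
    (Y : Matrix n n ℂ) :
    variationalForm s ((hB.eigenvectorUnitary : Matrix n n ℂ) * Y *
        (hA.eigenvectorUnitary : Matrix n n ℂ)ᴴ) A B =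
      ∑ i, ∑ j, (2 * (hA.eigenvalues i * (star (Y j i) *
        ((hB.eigenvectorUnitary : Matrix n n ℂ)ᴴ *
          (hA.eigenvectorUnitary : Matrix n n ℂ)) j i).re) -
        Complex.normSq (Y j i) * (hB.eigenvalues j + s * hA.eigenvalues i)) := by
  set U := (hA.eigenvectorUnitary : Matrix n n ℂ) with hU
  set V := (hB.eigenvectorUnitary : Matrix n n ℂ) with hV
  have hUU : Uᴴ * U = 1 := hA.eigenvectorUnitary_conjTranspose_mul
  have hVV : Vᴴ * V = 1 := hB.eigenvectorUnitary_conjTranspose_mul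
  have hA' : A = U * diagonal (fun i => (hA.eigenvalues i : ℂ)) * Uᴴ :=
    hA.eq_unitary_mul_diagonal
  have hB' : B = V * diagonal (fun i => (hB.eigenvalues i : ℂ)) * Vᴴ :=
    hB.eq_unitary_mul_diagonal
  generalize hA.eigenvalues = p at *
  generalize hB.eigenvalues = q at *
  have h1 : ((V * Y * Uᴴ)ᴴ * A).trace.re =
      ∑ i, ∑ j, p i * (star (Y j i) * (Vᴴ * U) j i).re := by
    have : ((V * Y * Uᴴ)ᴴ * A).trace =
        (Yᴴ * (Vᴴ * U) * diagonal (fun i => (p i : ℂ))).trace := by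
      rw [hA']
      simp only [conjTranspose_mul, conjTranspose_conjTranspose]
      rw [Matrix.mul_assoc, Matrix.trace_mul_comm]
      simp only [Matrix.mul_assoc, hUU, mul_one]
    rw [this, trace, Complex.re_sum]
    refine Finset.sum_congr rfl fun i _ => ?_
    rw [diag_apply, mul_diagonal, mul_apply, Finset.sum_mul, Complex.re_sum]
    refine Finset.sum_congr rfl fun j _ => ?_
    rw [conjTranspose_apply, Complex.re_mul_ofReal, mul_comm]
  have h2 : ((V * Y * Uᴴ)ᴴ * B * (V * Y * Uᴴ)).trace.re =
      ∑ i, ∑ j, Complex.normSq (Y j i) * q j := by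
    have : ((V * Y * Uᴴ)ᴴ * B * (V * Y * Uᴴ)).trace =
        (Yᴴ * diagonal (fun i => (q i : ℂ)) * Y).trace := by
      rw [hB']
      simp only [conjTranspose_mul, conjTranspose_conjTranspose]
      simp only [Matrix.mul_assoc]
      rw [Matrix.trace_mul_comm]
      simp only [Matrix.mul_assoc, hUU, mul_one]
      rw [← Matrix.mul_assoc Vᴴ V, hVV, one_mul, ← Matrix.mul_assoc Vᴴ V, hVV, one_mul]
    rw [this, trace, Complex.re_sum]
    refine Finset.sum_congr rfl fun i _ => ?_
    rw [diag_apply, mul_apply, Complex.re_sum]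
    refine Finset.sum_congr rfl fun j _ => ?_
    rw [mul_diagonal, conjTranspose_apply, Complex.star_def, mul_right_comm,
      ← Complex.normSq_eq_conj_mul_self, ← Complex.ofReal_mul, Complex.ofReal_re]
  have h3 : ((V * Y * Uᴴ) * A * (V * Y * Uᴴ)ᴴ).trace.re =
      ∑ i, ∑ j, Complex.normSq (Y j i) * p i := by
    have : ((V * Y * Uᴴ) * A * (V * Y * Uᴴ)ᴴ).trace =
        (Y * diagonal (fun i => (p i : ℂ)) * Yᴴ).trace := by
      rw [hA']
      simp only [conjTranspose_mul, conjTranspose_conjTranspose]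
      simp only [Matrix.mul_assoc]
      rw [Matrix.trace_mul_comm]
      simp only [Matrix.mul_assoc, hVV, mul_one]
      rw [← Matrix.mul_assoc Uᴴ U, hUU, one_mul, ← Matrix.mul_assoc Uᴴ U, hUU, one_mul]
    rw [this, trace, Complex.re_sum, Finset.sum_comm]
    refine Finset.sum_congr rfl fun i _ => ?_
    rw [diag_apply, mul_apply, Complex.re_sum]
    refine Finset.sum_congr rfl fun j _ => ?_
    rw [mul_diagonal, conjTranspose_apply, Complex.star_def, mul_right_comm,
      Complex.mul_conj, ← Complex.ofReal_mul, Complex.ofReal_re]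
  rw [variationalForm, h1, h2, h3]
  simp_rw [Finset.mul_sum, ← Finset.sum_sub_distrib]
  refine Finset.sum_congr rfl fun i _ => Finset.sum_congr rfl fun j _ => ?_
  ring

theorem variationalForm_le_resolventForm {s : ℝ} (hs : 0 < s) (hA : A.PosSemidef)
    (hB : B.PosSemidef) (X : Matrix n n ℂ) :
    variationalForm s X A B ≤ resolventForm s hA.isHermitian hB.isHermitian := by
  set U := (hA.isHermitian.eigenvectorUnitary : Matrix n n ℂ) with hU
  set V := (hB.isHermitian.eigenvectorUnitary : Matrix n n ℂ) with hV
  have hX : X = V * (Vᴴ * X * U) * Uᴴ := by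
    have hUU : U * Uᴴ = 1 := hA.isHermitian.eigenvectorUnitary_mul_conjTranspose
    have hVV : V * Vᴴ = 1 := hB.isHermitian.eigenvectorUnitary_mul_conjTranspose
    rw [← Matrix.mul_assoc, ← Matrix.mul_assoc, hVV, one_mul, Matrix.mul_assoc, hUU, mul_one]
  rw [hX, variationalForm_eigenvectorUnitary, resolventForm]
  refine Finset.sum_le_sum fun i _ => Finset.sum_le_sum fun j _ => ?_
  rw [overlap_comm, overlap]
  simp only [← hU, ← hV]
  have hp := hA.eigenvalues_nonneg i
  have hq := hB.eigenvalues_nonneg j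
  generalize (Vᴴ * X * U) j i = y
  generalize (Vᴴ * U) j i = w
  generalize hA.isHermitian.eigenvalues i = p at *
  generalize hB.isHermitian.eigenvalues j = q at *
  rcases hp.eq_or_lt with rfl | hp
  · simpa using mul_nonneg (Complex.normSq_nonneg y) hq
  have hc : 0 < q + s * p := by positivity
  rw [← mul_div_assoc, le_div_iff₀ hc]
  simp only [Complex.normSq_apply, Complex.star_def, Complex.mul_re, Complex.conj_re,
    Complex.conj_im]
  nlinarith [sq_nonneg (y.re * (q + s * p) - p * w.re), sq_nonneg (y.im * (q + s * p) - p * w.im)]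

theorem exists_variationalForm_eq_resolventForm {s : ℝ} (hs : 0 < s) (hA : A.PosSemidef)
    (hB : B.PosSemidef) :
    ∃ X, variationalForm s X A B = resolventForm s hA.isHermitian hB.isHermitian := by
  refine ⟨_, (variationalForm_eigenvectorUnitary s hA.isHermitian hB.isHermitian
    (Matrix.of fun j i => ((hA.isHermitian.eigenvalues i /
      (hB.isHermitian.eigenvalues j + s * hA.isHermitian.eigenvalues i) : ℝ) : ℂ) *
      ((hB.isHermitian.eigenvectorUnitary : Matrix n n ℂ)ᴴ *
          (hA.isHermitian.eigenvectorUnitary : Matrix n n ℂ)) j i)).trans ?_⟩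
  rw [resolventForm]
  refine Finset.sum_congr rfl fun i _ => Finset.sum_congr rfl fun j _ => ?_
  rw [overlap_comm, overlap, of_apply]
  have hp := hA.eigenvalues_nonneg i
  have hq := hB.eigenvalues_nonneg j
  generalize ((hB.isHermitian.eigenvectorUnitary : Matrix n n ℂ)ᴴ *
    (hA.isHermitian.eigenvectorUnitary : Matrix n n ℂ)) j i = w
  generalize hA.isHermitian.eigenvalues i = p at *
  generalize hB.isHermitian.eigenvalues j = q at *
  rcases hp.eq_or_lt with rfl | hp
  · simp
  have hc : q + s * p ≠ 0 := by positivity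
  have h : (star (((p / (q + s * p) : ℝ) : ℂ) * w) * w).re =
      p / (q + s * p) * Complex.normSq w := by
    rw [Complex.star_def, map_mul, Complex.conj_ofReal, mul_assoc,
      ← Complex.normSq_eq_conj_mul_self, ← Complex.ofReal_mul, Complex.ofReal_re]
  rw [h, Complex.normSq_mul, Complex.normSq_ofReal]
  field_simp
  ring

/-- The integral of `resolventForm` over `[0, s]`. -/
def logForm (s : ℝ) (hA : A.IsHermitian) (hB : B.IsHermitian) : ℝ :=
  ∑ i, ∑ j, overlap hA hB i j * (hA.eigenvalues i *
    (Real.log (hB.eigenvalues j + s * hA.eigenvalues i) - Real.log (hB.eigenvalues j)))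

theorem logForm_zero (hA : A.IsHermitian) (hB : B.IsHermitian) : logForm 0 hA hB = 0 := by
  simp [logForm]

theorem hasDerivAt_logForm {s : ℝ} (hs : 0 < s) (hA : A.PosSemidef) (hB : B.PosSemidef) :
    HasDerivAt (fun s => logForm s hA.isHermitian hB.isHermitian)
      (resolventForm s hA.isHermitian hB.isHermitian) s := by
  refine HasDerivAt.fun_sum fun i _ => HasDerivAt.fun_sum fun j _ => HasDerivAt.const_mul _ ?_
  have hp := hA.eigenvalues_nonneg i
  have hq := hB.eigenvalues_nonneg j
  generalize hA.isHermitian.eigenvalues i = p at *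
  generalize hB.isHermitian.eigenvalues j = q at *
  rcases hp.eq_or_lt with rfl | hp
  · simpa using hasDerivAt_const s (0 : ℝ)
  have hc : q + s * p ≠ 0 := by positivity
  convert (((((hasDerivAt_id' s).mul_const p).const_add q).log hc).sub_const
    (Real.log q)).const_mul p using 1
  ring

theorem continuousOn_logForm (hA : A.PosSemidef) (hB : B.PosSemidef)
    (hAB : (B - A).PosSemidef) :
    ContinuousOn (fun s => logForm s hA.isHermitian hB.isHermitian) (Set.Ici 0) := by
  refine continuousOn_finsetSum _ fun i _ => continuousOn_finsetSum _ fun j _ => ?_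
  rcases (hB.eigenvalues_nonneg j).eq_or_lt with hj | hq
  · have h := overlap_mul_eigenvalues_eq_zero hA hB.isHermitian hAB i hj.symm
    simp_rw [← mul_assoc, h, zero_mul]
    exact continuousOn_const
  · have hp := hA.eigenvalues_nonneg i
    refine continuousOn_const.mul (continuousOn_const.mul (ContinuousOn.sub
      (ContinuousOn.log (by fun_prop) fun s hs => ?_) continuousOn_const))
    have : 0 ≤ s * hA.isHermitian.eigenvalues i := mul_nonneg hs hp
    positivity

theorem tendsto_logForm_sub (hA : A.PosSemidef) (hB : B.PosSemidef) :
    Filter.Tendsto (fun s => logForm s hA.isHermitian hB.isHermitian - A.trace.re * Real.log s)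
      Filter.atTop (nhds (relEnt A B)) := by
  have h : ∀ s, logForm s hA.isHermitian hB.isHermitian - A.trace.re * Real.log s =
      ∑ i, ∑ j, overlap hA.isHermitian hB.isHermitian i j * (hA.isHermitian.eigenvalues i *
        (Real.log (hB.isHermitian.eigenvalues j + s * hA.isHermitian.eigenvalues i) - Real.log s -
          Real.log (hB.isHermitian.eigenvalues j))) := fun s => by
    rw [logForm, hA.isHermitian.re_trace_eq_sum, Finset.sum_mul,
      ← sum_overlap_mul_left hA.isHermitian hB.isHermitian
        fun i => hA.isHermitian.eigenvalues i * Real.log s]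
    simp_rw [← Finset.sum_sub_distrib]
    refine Finset.sum_congr rfl fun i _ => Finset.sum_congr rfl fun j _ => ?_
    ring
  simp_rw [h, relEnt_eq_sum hA.isHermitian hB.isHermitian]
  refine tendsto_finsetSum _ fun i _ => tendsto_finsetSum _ fun j _ =>
    Filter.Tendsto.const_mul _ ?_
  have hp := hA.eigenvalues_nonneg i
  have hq := hB.eigenvalues_nonneg j
  generalize hA.isHermitian.eigenvalues i = p at *
  generalize hB.isHermitian.eigenvalues j = q at *
  rcases hp.eq_or_lt with rfl | hp
  · simp
  refine Filter.Tendsto.const_mul _ (Filter.Tendsto.sub_const ?_ _)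
  have h1 : Filter.Tendsto (fun s : ℝ => Real.log (q / s + p)) Filter.atTop
      (nhds (Real.log p)) := by
    have h2 : Filter.Tendsto (fun s : ℝ => q / s + p) Filter.atTop (nhds (0 + p)) :=
      (Filter.Tendsto.div_atTop tendsto_const_nhds Filter.tendsto_id).add_const p
    rw [zero_add] at h2
    exact h2.log hp.ne'
  refine h1.congr' ?_
  filter_upwards [Filter.eventually_gt_atTop 0] with s hs
  rw [← Real.log_div (by positivity) hs.ne']
  congr 1
  field_simp

theorem relEnt_le_relEnt_of_resolventForm_le (hA : A.PosSemidef) (hB : B.PosSemidef)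
    (hAB : (B - A).PosSemidef) (hA' : A'.PosSemidef) (hB' : B'.PosSemidef)
    (hAB' : (B' - A').PosSemidef) (htr : A.trace.re = A'.trace.re)
    (h : ∀ s, 0 < s → resolventForm s hA.isHermitian hB.isHermitian ≤
      resolventForm s hA'.isHermitian hB'.isHermitian) :
    relEnt A B ≤ relEnt A' B' := by
  refine le_of_tendsto_of_tendsto (tendsto_logForm_sub hA hB)
    (tendsto_logForm_sub hA' hB') ?_
  filter_upwards [Filter.eventually_ge_atTop 0] with s hs
  rw [htr, sub_le_sub_iff_right, ← sub_nonpos]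
  have hanti : AntitoneOn (fun s => logForm s hA.isHermitian hB.isHermitian -
      logForm s hA'.isHermitian hB'.isHermitian) (Set.Ici 0) := by
    refine antitoneOn_of_hasDerivWithinAt_nonpos (convex_Ici 0)
      ((continuousOn_logForm hA hB hAB).sub (continuousOn_logForm hA' hB' hAB'))
      (f' := fun s => resolventForm s hA.isHermitian hB.isHermitian -
        resolventForm s hA'.isHermitian hB'.isHermitian) ?_ ?_
    · intro x hx
      rw [interior_Ici] at hx
      exact ((hasDerivAt_logForm hx hA hB).sub (hasDerivAt_logForm hx hA' hB')).hasDerivWithinAt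
    · intro x hx
      rw [interior_Ici] at hx
      exact sub_nonpos.2 (h x hx)
  have := hanti Set.self_mem_Ici (Set.mem_Ici.2 hs) hs
  simpa [logForm_zero] using this

theorem relEnt_nonpos_of_le (hA : A.PosSemidef) (hB : B.PosSemidef) (hAB : (B - A).PosSemidef) :
    relEnt A B ≤ 0 := by
  have h0 : relEnt A A = 0 := by rw [relEnt, sub_self, Complex.zero_re]
  rw [← h0]
  refine relEnt_le_relEnt_of_resolventForm_le hA hB hAB hA hA (by simpa using PosSemidef.zero) rfl
    fun s hs => ?_
  obtain ⟨X, hX⟩ := exists_variationalForm_eq_resolventForm hs hA hB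
  rw [← hX]
  refine le_trans ?_ (variationalForm_le_resolventForm hs hA hA X)
  have h := (hAB.conjTranspose_mul_mul_same X).re_trace_nonneg
  rw [Matrix.mul_sub, Matrix.sub_mul, trace_sub, Complex.sub_re] at h
  rw [variationalForm, variationalForm]
  linarith

/-- Klein's inequality for matrices of arbitrary trace. -/
theorem re_trace_mul_log_le_relEnt (hA : A.PosSemidef) (hB : B.PosSemidef)
    (hAB : (B - A).PosSemidef) :
    A.trace.re * Real.log (A.trace.re / B.trace.re) ≤ relEnt A B := by
  rcases hA.re_trace_nonneg.eq_or_lt with h0 | hpos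
  · have hA0 : A = 0 := hA.trace_eq_zero_iff.1
      (Complex.ext h0.symm (Complex.nonneg_iff.mp hA.trace_nonneg).2.symm)
    subst hA0
    simp [relEnt]
  have hposB : 0 < B.trace.re := by
    have := hAB.re_trace_nonneg
    rw [trace_sub, Complex.sub_re] at this
    linarith
  obtain ⟨c, hc⟩ : ∃ c, c = A.trace.re / B.trace.re := ⟨_, rfl⟩
  have hc0 : 0 < c := hc ▸ div_pos hpos hposB
  have hcB : A.trace.re = c * B.trace.re := by rw [hc]; field_simp
  have key : A.trace.re * Real.log c = ∑ i, ∑ j,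
      overlap hA.isHermitian hB.isHermitian i j * (hA.isHermitian.eigenvalues i * Real.log c +
        hA.isHermitian.eigenvalues i - c * hB.isHermitian.eigenvalues j) := by
    simp_rw [mul_sub, mul_add, Finset.sum_sub_distrib, Finset.sum_add_distrib]
    rw [sum_overlap_mul_left _ _ fun i => hA.isHermitian.eigenvalues i * Real.log c,
      sum_overlap_mul_left, sum_overlap_mul_right _ _ fun j => c * hB.isHermitian.eigenvalues j,
      ← Finset.sum_mul, ← Finset.mul_sum, ← hA.isHermitian.re_trace_eq_sum,
      ← hB.isHermitian.re_trace_eq_sum]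
    linarith
  rw [← hc, key, relEnt_eq_sum hA.isHermitian hB.isHermitian]
  refine Finset.sum_le_sum fun i _ => Finset.sum_le_sum fun j _ => ?_
  have hsupp := overlap_mul_eigenvalues_eq_zero hA hB.isHermitian hAB i (j := j)
  have hw := overlap_nonneg hA.isHermitian hB.isHermitian i j
  have hp := hA.eigenvalues_nonneg i
  have hq := hB.eigenvalues_nonneg j
  generalize overlap hA.isHermitian hB.isHermitian i j = w at *
  generalize hA.isHermitian.eigenvalues i = p at *
  generalize hB.isHermitian.eigenvalues j = q at *
  rcases hq.eq_or_lt with hq0 | hq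
  · rw [← hq0, mul_zero, sub_zero, ← mul_add_one, ← mul_assoc, ← mul_assoc, hsupp hq0.symm]
    simp
  refine mul_le_mul_of_nonneg_left ?_ hw
  rcases hp.eq_or_lt with rfl | hp
  · simp; positivity
  have h := Real.log_le_sub_one_of_pos (show 0 < c * q / p by positivity)
  rw [Real.log_div (by positivity) hp.ne', Real.log_mul hc0.ne' hq.ne'] at h
  have h2 := mul_le_mul_of_nonneg_left h hp.le
  have h3 : p * (c * q / p - 1) = c * q - p := by field_simp
  rw [h3] at h2
  linarith

theorem relEnt_add_relEnt (A B C : Matrix n n ℂ) (h : A + B = C) :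
    relEnt A C + relEnt B C = vnEnt C - vnEnt A - vnEnt B := by
  subst h
  simp only [relEnt, vnEnt, Matrix.add_mul, trace_add, Complex.add_re, Complex.sub_re]
  ring

theorem Matrix.PosSemidef.re_trace_smul_one_sub (hA : A.PosSemidef) :
    ((A.trace.re : ℂ) • (1 : Matrix n n ℂ) - A).PosSemidef := by
  have h : (A.trace.re : ℂ) • (1 : Matrix n n ℂ) - A =
      (hA.isHermitian.eigenvectorUnitary : Matrix n n ℂ) *
        diagonal (fun i => ((A.trace.re - hA.isHermitian.eigenvalues i : ℝ) : ℂ)) *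
        (hA.isHermitian.eigenvectorUnitary : Matrix n n ℂ)ᴴ := by
    conv_lhs => enter [2]; rw [hA.isHermitian.eq_unitary_mul_diagonal]
    rw [← hA.isHermitian.eigenvectorUnitary_mul_conjTranspose]
    simp only [Complex.ofReal_sub]
    rw [← diagonal_sub, Matrix.mul_sub, Matrix.sub_mul, ← smul_one_eq_diagonal]
    simp
  rw [h]
  refine (PosSemidef.diagonal fun i => ?_).mul_mul_conjTranspose_same _
  rw [Pi.zero_apply, Complex.zero_le_real, sub_nonneg, hA.isHermitian.re_trace_eq_sum]
  exact Finset.single_le_sum (fun k _ => hA.eigenvalues_nonneg k) (Finset.mem_univ i)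

theorem relEnt_smul_one (A : Matrix n n ℂ) (c : ℝ) :
    relEnt A ((c : ℂ) • 1) = -vnEnt A - A.trace.re * Real.log c := by
  have hone : ((c : ℂ) • (1 : Matrix n n ℂ)) = algebraMap ℝ _ c := by
    rw [Algebra.algebraMap_eq_smul_one, Complex.coe_smul]
  have hherm : ((c : ℂ) • (1 : Matrix n n ℂ)).IsHermitian := by
    rw [hone]; exact IsSelfAdjoint.algebraMap _ (IsSelfAdjoint.all c)
  have hlog : matLog ((c : ℂ) • (1 : Matrix n n ℂ)) = (Real.log c : ℂ) • 1 := by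
    rw [matLog, herFun_eq_cfc _ hherm, hone, cfc_algebraMap, Algebra.algebraMap_eq_smul_one,
      Complex.coe_smul]
  rw [relEnt, vnEnt, hlog, Complex.sub_re, mul_smul_comm, mul_one, trace_smul, smul_eq_mul,
    Complex.re_ofReal_mul]
  ring

theorem neg_vnEnt_le (hA : A.PosSemidef) : -vnEnt A ≤ A.trace.re * Real.log A.trace.re := by
  have h := relEnt_nonpos_of_le hA (posSemidef_smul_one hA.re_trace_nonneg)
    hA.re_trace_smul_one_sub
  rw [relEnt_smul_one] at h
  linarith

theorem vnEnt_le [Nonempty n] (hA : A.PosSemidef) :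
    vnEnt A ≤ A.trace.re * Real.log (Fintype.card n) - A.trace.re * Real.log A.trace.re := by
  have h := re_trace_mul_log_le_relEnt hA (posSemidef_smul_one hA.re_trace_nonneg)
    hA.re_trace_smul_one_sub
  rw [relEnt_smul_one, trace_smul, trace_one, smul_eq_mul, Complex.re_ofReal_mul,
    Complex.natCast_re] at h
  rcases hA.re_trace_nonneg.eq_or_lt with h0 | hpos
  · rw [← h0] at h ⊢
    linarith
  · have hn : (0 : ℝ) < Fintype.card n := by exact_mod_cast Fintype.card_pos
    rw [div_mul_cancel_left₀ hpos.ne', Real.log_inv] at h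
    linarith

theorem vnEnt2_eq (hA : A.IsHermitian) : vnEnt2 A = vnEnt A / Real.log 2 := by
  rw [vnEnt2, vnEnt, matLog, re_trace_mul_herFun_self _ hA, re_trace_mul_herFun_self _ hA, neg_div,
    Finset.sum_div]
  simp only [Real.logb, mul_div_assoc]

theorem re_trace_herFun_mul_self_sqrt (hA : A.IsHermitian) :
    (herFun Real.sqrt (Aᴴ * A)).trace.re = ∑ i, |hA.eigenvalues i| := by
  have hA' : IsSelfAdjoint A := hA
  have hsq : Aᴴ * A = cfc (fun x : ℝ => x ^ 2) A := by
    rw [cfc_pow_id A 2, hA.eq, sq]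
  have hcont (f : ℝ → ℝ) : ContinuousOn f (spectrum ℝ A) :=
    (finite_real_spectrum (A := A)).continuousOn f
  rw [herFun_eq_cfc _ (isHermitian_conjTranspose_mul_self A), hsq,
    ← cfc_comp' Real.sqrt (fun x => x ^ 2) A Real.continuous_sqrt.continuousOn (hcont _)]
  simp only [Real.sqrt_sq_eq_abs]
  rw [← herFun_eq_cfc _ hA, trace_herFun _ hA]

theorem posSemidef_herFun {f : ℝ → ℝ} (hf : ∀ x, 0 ≤ f x) (hA : A.IsHermitian) :
    (herFun f A).PosSemidef := by
  rw [herFun_of_isHermitian f hA]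
  exact (PosSemidef.diagonal fun i => by simpa using hf _).mul_mul_conjTranspose_same _

/-- Jordan decomposition of the difference of two Hermitian matrices of equal trace. -/
theorem exists_posSemidef_add_eq_add (hA : A.IsHermitian) (hB : B.IsHermitian)
    (htr : A.trace = B.trace) :
    ∃ M N : Matrix n n ℂ, M.PosSemidef ∧ N.PosSemidef ∧ B + M = A + N ∧
      M.trace.re = traceDist A B ∧ N.trace.re = traceDist A B := by
  have hH : (A - B).IsHermitian := hA.sub hB
  refine ⟨herFun (fun x => max x 0) (A - B), herFun (fun x => max (-x) 0) (A - B),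
    posSemidef_herFun (fun x => le_max_right _ _) hH,
    posSemidef_herFun (fun x => le_max_right _ _) hH, ?_, ?_⟩
  · have : herFun (fun x => max x 0) (A - B) - herFun (fun x => max (-x) 0) (A - B) = A - B := by
      conv_rhs => rw [hH.eq_unitary_mul_diagonal]
      rw [herFun_of_isHermitian _ hH, herFun_of_isHermitian _ hH, ← Matrix.sub_mul,
        ← Matrix.mul_sub, diagonal_sub]
      simp only [← Complex.ofReal_sub, max_zero_sub_max_neg_zero_eq_self]
    rw [add_comm, sub_eq_sub_iff_add_eq_add.1 this]
  · have h0 : ∑ i, hH.eigenvalues i = 0 := by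
      rw [← hH.re_trace_eq_sum, trace_sub, htr, sub_self, Complex.zero_re]
    have h1 : ∑ i, max (hH.eigenvalues i) 0 - ∑ i, max (-hH.eigenvalues i) 0 = 0 := by
      rw [← Finset.sum_sub_distrib]
      simpa only [max_zero_sub_max_neg_zero_eq_self] using h0
    have h2 : ∑ i, max (hH.eigenvalues i) 0 + ∑ i, max (-hH.eigenvalues i) 0 =
        ∑ i, |hH.eigenvalues i| := by
      rw [← Finset.sum_add_distrib]
      simp only [max_zero_add_max_neg_zero_eq_abs_self]
    rw [trace_herFun _ hH, trace_herFun _ hH, traceDist, re_trace_herFun_mul_self_sqrt hH, ← h2]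
    constructor <;> linarith

end Spectral

section Pinching

/-- The pinching `A ↦ ∑ j, P j * A * P j`. -/
def pinch {n ι : Type*} [Fintype n] [Fintype ι] (P : ι → Matrix n n ℂ) (A : Matrix n n ℂ) :
    Matrix n n ℂ :=
  ∑ j, P j * A * P j

variable {n ι : Type*} [Fintype n] [Fintype ι] {P : ι → Matrix n n ℂ} {A B : Matrix n n ℂ}

theorem pinch_add (P : ι → Matrix n n ℂ) (A B : Matrix n n ℂ) :
    pinch P (A + B) = pinch P A + pinch P B := by
  simp only [pinch, Matrix.mul_add, Matrix.add_mul, Finset.sum_add_distrib]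

theorem pinch_sub (P : ι → Matrix n n ℂ) (A B : Matrix n n ℂ) :
    pinch P (A - B) = pinch P A - pinch P B := by
  simp only [pinch, Matrix.mul_sub, Matrix.sub_mul, Finset.sum_sub_distrib]

theorem trace_mul_pinch (P : ι → Matrix n n ℂ) (A B : Matrix n n ℂ) :
    (A * pinch P B).trace = (pinch P A * B).trace := by
  simp only [pinch, Finset.mul_sum, Finset.sum_mul, trace_sum]
  refine Finset.sum_congr rfl fun j _ => ?_
  rw [← Matrix.mul_assoc, Matrix.trace_mul_comm]
  simp only [Matrix.mul_assoc]

theorem conjTranspose_pinch (hherm : ∀ j, (P j).IsHermitian) (A : Matrix n n ℂ) :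
    (pinch P A)ᴴ = pinch P Aᴴ := by
  simp only [pinch, conjTranspose_sum, conjTranspose_mul, (hherm _).eq, Matrix.mul_assoc]

theorem Matrix.PosSemidef.pinch (hherm : ∀ j, (P j).IsHermitian) (hA : A.PosSemidef) :
    (pinch P A).PosSemidef := by
  refine posSemidef_sum _ fun j _ => ?_
  have h := hA.mul_mul_conjTranspose_same (P j)
  rwa [(hherm j).eq] at h

variable [DecidableEq n]

theorem pinch_one (hproj : ∀ j, P j * P j = P j) (hsum : ∑ j, P j = 1) :
    pinch P 1 = 1 := by
  simp only [pinch, mul_one, hproj, hsum]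

theorem pinch_smul_one (hproj : ∀ j, P j * P j = P j) (hsum : ∑ j, P j = 1) (c : ℂ) :
    pinch P (c • 1) = c • 1 := by
  simp only [pinch, mul_smul_comm, smul_mul_assoc, mul_one, hproj, ← Finset.smul_sum, hsum]

theorem trace_pinch (hproj : ∀ j, P j * P j = P j) (hsum : ∑ j, P j = 1) (A : Matrix n n ℂ) :
    (pinch P A).trace = A.trace := by
  have h := trace_mul_pinch P 1 A
  rwa [pinch_one hproj hsum, one_mul, one_mul] at h

theorem re_trace_conjTranspose_pinch_mul_le (hherm : ∀ j, (P j).IsHermitian)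
    (hproj : ∀ j, P j * P j = P j) (horth : ∀ j k, j ≠ k → P j * P k = 0)
    (hsum : ∑ j, P j = 1) (hB : B.PosSemidef) (X : Matrix n n ℂ) :
    ((pinch P X)ᴴ * B * pinch P X).trace.re ≤ (Xᴴ * pinch P B * X).trace.re := by
  classical
  have hC : ∀ j k, 0 ≤ (P k * (Xᴴ * (P j * B * P j) * X) * P k).trace.re := fun j k => by
    have h := ((hB.mul_mul_conjTranspose_same (P j)).conjTranspose_mul_mul_same
      X).mul_mul_conjTranspose_same (P k)
    rw [(hherm j).eq, (hherm k).eq] at h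
    exact h.re_trace_nonneg
  have h1 : ((pinch P X)ᴴ * B * pinch P X).trace.re =
      ∑ j, (P j * (Xᴴ * (P j * B * P j) * X) * P j).trace.re := by
    rw [conjTranspose_pinch hherm, pinch, pinch, Finset.mul_sum, trace_sum, Complex.re_sum]
    refine Finset.sum_congr rfl fun j _ => ?_
    rw [Finset.sum_mul, Finset.sum_mul, trace_sum, Complex.re_sum, Finset.sum_eq_single j]
    · simp only [Matrix.mul_assoc]
    · intro k _ hk
      have : (P k * Xᴴ * P k * B * (P j * X * P j)).trace = 0 := by
        rw [← Matrix.mul_assoc, Matrix.trace_mul_comm]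
        simp only [← Matrix.mul_assoc]
        simp [horth j k hk.symm]
      rw [this, Complex.zero_re]
    · simp
  have h2 : (Xᴴ * pinch P B * X).trace.re =
      ∑ j, ∑ k, (P k * (Xᴴ * (P j * B * P j) * X) * P k).trace.re := by
    rw [pinch, Finset.mul_sum, Finset.sum_mul, trace_sum, Complex.re_sum]
    refine Finset.sum_congr rfl fun j _ => ?_
    rw [← trace_pinch hproj hsum (Xᴴ * (P j * B * P j) * X), pinch, trace_sum, Complex.re_sum]
  rw [h1, h2]
  exact Finset.sum_le_sum fun j _ =>
    Finset.single_le_sum (f := fun k => (P k * (Xᴴ * (P j * B * P j) * X) * P k).trace.re)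
      (fun k _ => hC j k) (Finset.mem_univ j)

/-- Relative entropy does not increase under pinching. -/
theorem relEnt_pinch_le (hherm : ∀ j, (P j).IsHermitian)
    (hproj : ∀ j, P j * P j = P j) (horth : ∀ j k, j ≠ k → P j * P k = 0)
    (hsum : ∑ j, P j = 1) (hA : A.PosSemidef) (hB : B.PosSemidef) (hAB : (B - A).PosSemidef) :
    relEnt (pinch P A) (pinch P B) ≤ relEnt A B := by
  refine relEnt_le_relEnt_of_resolventForm_le (hA.pinch hherm) (hB.pinch hherm)
    (pinch_sub P B A ▸ hAB.pinch hherm) hA hB hAB (by rw [trace_pinch hproj hsum])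
    fun s hs => ?_
  obtain ⟨X, hX⟩ :=
    exists_variationalForm_eq_resolventForm hs (hA.pinch hherm) (hB.pinch hherm)
  rw [← hX]
  refine le_trans ?_ (variationalForm_le_resolventForm hs hA hB (pinch P X))
  have h1 := re_trace_conjTranspose_pinch_mul_le hherm hproj horth hsum hB X
  have h2 := re_trace_conjTranspose_pinch_mul_le hherm hproj horth hsum hA Xᴴ
  rw [← conjTranspose_pinch hherm, conjTranspose_conjTranspose, conjTranspose_conjTranspose] at h2
  have h3 := mul_le_mul_of_nonneg_left h2 hs.le
  rw [variationalForm, variationalForm, trace_mul_pinch, conjTranspose_pinch hherm]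
  rw [conjTranspose_pinch hherm] at h1 h3
  linarith

theorem vnEnt_le_vnEnt_pinch (hherm : ∀ j, (P j).IsHermitian)
    (hproj : ∀ j, P j * P j = P j) (horth : ∀ j k, j ≠ k → P j * P k = 0)
    (hsum : ∑ j, P j = 1) (hA : A.PosSemidef) : vnEnt A ≤ vnEnt (pinch P A) := by
  have h := relEnt_pinch_le hherm hproj horth hsum hA (posSemidef_smul_one hA.re_trace_nonneg)
    hA.re_trace_smul_one_sub
  rw [pinch_smul_one hproj hsum, relEnt_smul_one, relEnt_smul_one, trace_pinch hproj hsum] at h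
  linarith

theorem vnEnt_pinch_sub_vnEnt_sub_le [Nonempty n] (hherm : ∀ j, (P j).IsHermitian)
    (hproj : ∀ j, P j * P j = P j) (horth : ∀ j k, j ≠ k → P j * P k = 0)
    (hsum : ∑ j, P j = 1) {ρ σ : Matrix n n ℂ} (hρ : ρ.PosSemidef) (hρtr : ρ.trace = 1)
    (hσ : σ.PosSemidef) (hσtr : σ.trace = 1) :
    (vnEnt (pinch P σ) - vnEnt σ) - (vnEnt (pinch P ρ) - vnEnt ρ) ≤
      traceDist ρ σ * Real.log (Fintype.card n) +
        (1 + traceDist ρ σ) * Real.log (1 + traceDist ρ σ) -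
        traceDist ρ σ * Real.log (traceDist ρ σ) := by
  obtain ⟨M, N, hM, hN, hMN, hMtr, hNtr⟩ :=
    exists_posSemidef_add_eq_add hρ.isHermitian hσ.isHermitian (hρtr.trans hσtr.symm)
  have hε : 0 ≤ traceDist ρ σ := hMtr ▸ hM.re_trace_nonneg
  generalize traceDist ρ σ = ε at *
  obtain ⟨ω, hω⟩ : ∃ ω, ρ + N = ω := ⟨_, rfl⟩
  have hω' : σ + M = ω := hMN.trans hω
  have hωpos : ω.PosSemidef := hω ▸ hρ.add hN
  have hωtr : ω.trace.re = 1 + ε := by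
    rw [← hω, trace_add, Complex.add_re, hρtr, hNtr, Complex.one_re]
  have hωρ : (ω - ρ).PosSemidef := by rw [← hω]; simpa using hN
  have hωN : (ω - N).PosSemidef := by rw [← hω]; simpa using hρ
  have hωσ : (ω - σ).PosSemidef := by rw [← hω']; simpa using hM
  have hωM : (ω - M).PosSemidef := by rw [← hω']; simpa using hσ
  have convexity_ρ := relEnt_pinch_le hherm hproj horth hsum hρ hωpos hωρ
  have convexity_N := relEnt_pinch_le hherm hproj horth hsum hN hωpos hωN
  have sub_σ := relEnt_nonpos_of_le hσ hωpos hωσ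
  have sub_M := relEnt_nonpos_of_le hM hωpos hωM
  have klein_σ := re_trace_mul_log_le_relEnt (hσ.pinch hherm) (hωpos.pinch hherm)
    (pinch_sub P ω σ ▸ hωσ.pinch hherm)
  have klein_M := re_trace_mul_log_le_relEnt (hM.pinch hherm) (hωpos.pinch hherm)
    (pinch_sub P ω M ▸ hωM.pinch hherm)
  simp only [trace_pinch hproj hsum, hσtr, hMtr, hωtr, Complex.one_re] at klein_σ klein_M
  have e1 := relEnt_add_relEnt ρ N ω hω
  have e2 := relEnt_add_relEnt σ M ω hω'
  have e3 := relEnt_add_relEnt _ _ _ ((pinch_add P ρ N).symm.trans (congrArg (pinch P) hω))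
  have e4 := relEnt_add_relEnt _ _ _ ((pinch_add P σ M).symm.trans (congrArg (pinch P) hω'))
  have hM0 := vnEnt_le_vnEnt_pinch hherm hproj horth hsum hM
  have hN1 := neg_vnEnt_le hN
  have hN2 := vnEnt_le (hN.pinch hherm)
  rw [trace_pinch hproj hsum, hNtr] at hN2
  rw [hNtr] at hN1
  have l1 : Real.log (1 / (1 + ε)) = -Real.log (1 + ε) := by rw [one_div, Real.log_inv]
  have l2 : ε * Real.log (ε / (1 + ε)) = ε * Real.log ε - ε * Real.log (1 + ε) := by
    rcases hε.eq_or_lt with rfl | hε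
    · simp
    · rw [Real.log_div hε.ne' (by positivity)]; ring
  rw [one_mul, l1] at klein_σ
  rw [l2] at klein_M
  linarith

end Pinching

theorem traceDist_nonneg {n : Type*} [Fintype n] [DecidableEq n] {A B : Matrix n n ℂ}
    (hA : A.IsHermitian) (hB : B.IsHermitian) : 0 ≤ traceDist A B := by
  rw [traceDist, re_trace_herFun_mul_self_sqrt (hA.sub hB)]
  exact mul_nonneg (by norm_num) (Finset.sum_nonneg fun _ _ => abs_nonneg _)

theorem traceDist_comm {n : Type*} [Fintype n] [DecidableEq n] (A B : Matrix n n ℂ) :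
    traceDist A B = traceDist B A := by
  rw [traceDist, traceDist, ← neg_sub B A, conjTranspose_neg, neg_mul_neg]

theorem one_add_mul_log_one_add_le {t d : ℝ} (ht : 0 ≤ t) (ht' : t ≤ 1 / Real.exp 1)
    (hd : 2 ≤ d) :
    (1 + t) * Real.log (1 + t) ≤ t * Real.log d - t * Real.log t := by
  rcases ht.eq_or_lt with rfl | ht
  · simp
  have h1 : Real.log (1 + t) ≤ t := by
    have := Real.log_le_sub_one_of_pos (show 0 < 1 + t by positivity)
    linarith
  have h2 : Real.log t ≤ -1 := by
    have := Real.log_le_log ht ht'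
    rwa [one_div, Real.log_inv, Real.log_exp] at this
  have h3 : 0.6931471803 < Real.log d :=
    Real.log_two_gt_d9.trans_le (Real.log_le_log (by norm_num) hd)
  have h4 : t ≤ 1 / 2 := by
    refine ht'.trans (one_div_le_one_div_of_le (by norm_num) ?_)
    linarith [Real.exp_one_gt_d9]
  calc (1 + t) * Real.log (1 + t) ≤ (1 + t) * t := by gcongr
    _ = t * (1 + t) := mul_comm _ _
    _ ≤ t * (Real.log d - Real.log t) := by gcongr; linarith
    _ = _ := mul_sub _ _ _

/-- Continuity of coherence: if two density operators on a d-dimensional space are at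
trace distance `T ≤ 1/e`, then their coherences (w.r.t. a projective measurement) differ by
at most `2 (T log₂ d - T log₂ T)`. -/
theorem coherence_continuity
    {d : ℕ} {m : ℕ}
    (ρ σ : Matrix (Fin d) (Fin d) ℂ)
    (hρ : ρ.PosSemidef) (hρtr : ρ.trace = 1)
    (hσ : σ.PosSemidef) (hσtr : σ.trace = 1)
    (P : Fin m → Matrix (Fin d) (Fin d) ℂ)
    (hherm : ∀ j, (P j).IsHermitian)
    (hproj : ∀ j, P j * P j = P j)
    (horth : ∀ j k, j ≠ k → P j * P k = 0)
    (hsum : ∑ j, P j = 1)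
    (hT : traceDist ρ σ ≤ 1 / Real.exp 1) :
    |coherence2 ρ P - coherence2 σ P| ≤
      2 * (traceDist ρ σ * Real.logb 2 d - traceDist ρ σ * Real.logb 2 (traceDist ρ σ)) := by
  have hTnn := traceDist_nonneg hρ.isHermitian hσ.isHermitian
  have hlogT : Real.logb 2 (traceDist ρ σ) ≤ 0 :=
    Real.logb_nonpos (by norm_num) hTnn (hT.trans (by
      rw [div_le_one (Real.exp_pos 1)]; exact Real.one_le_exp zero_le_one))
  have hTlog : traceDist ρ σ * Real.logb 2 (traceDist ρ σ) ≤ 0 :=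
    mul_nonpos_of_nonneg_of_nonpos hTnn hlogT
  rcases Nat.lt_or_ge d 2 with hd | hd
  · have hsub : Subsingleton (Fin d) := Fin.subsingleton_iff_le_one.2 (by lia)
    have hentry : ∀ (A : Matrix (Fin d) (Fin d) ℂ) i j, A i j = A.trace := fun A i j => by
      rw [Subsingleton.elim j i, trace, Fintype.sum_subsingleton _ i, diag_apply]
    have heq : ρ = σ := by
      ext i j
      rw [hentry ρ, hentry σ, hρtr, hσtr]
    have hlogd : 0 ≤ Real.logb 2 d := by
      rw [Real.logb]
      exact div_nonneg (Real.log_natCast_nonneg d) (Real.log_nonneg (by norm_num))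
    have := mul_nonneg hTnn hlogd
    rw [← heq] at this hTlog ⊢
    rw [sub_self, abs_zero]
    linarith
  have : Nonempty (Fin d) := ⟨⟨0, by lia⟩⟩
  have hcoh : ∀ τ : Matrix (Fin d) (Fin d) ℂ, τ.PosSemidef →
      coherence2 τ P = (vnEnt (pinch P τ) - vnEnt τ) / Real.log 2 := fun τ hτ => by
    rw [sub_div, ← vnEnt2_eq hτ.isHermitian, ← vnEnt2_eq (hτ.pinch hherm).isHermitian]
    rfl
  have h1 := vnEnt_pinch_sub_vnEnt_sub_le hherm hproj horth hsum hρ hρtr hσ hσtr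
  have h2 := vnEnt_pinch_sub_vnEnt_sub_le hherm hproj horth hsum hσ hσtr hρ hρtr
  have h3 := one_add_mul_log_one_add_le hTnn hT (show (2 : ℝ) ≤ d by exact_mod_cast hd)
  rw [traceDist_comm σ ρ] at h2
  rw [Fintype.card_fin] at h1 h2
  have hlog2 : 0 < Real.log 2 := Real.log_pos (by norm_num)
  have hrhs : 2 * (traceDist ρ σ * Real.logb 2 d -
      traceDist ρ σ * Real.logb 2 (traceDist ρ σ)) =
      2 * (traceDist ρ σ * Real.log d - traceDist ρ σ * Real.log (traceDist ρ σ)) /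
        Real.log 2 := by
    rw [Real.logb, Real.logb]
    ring
  rw [hcoh ρ hρ, hcoh σ hσ, hrhs, ← sub_div, abs_div, abs_of_pos hlog2]
  gcongr
  rw [abs_le]
  constructor <;> linarith
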